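/- Let U ⊆ ℝⁿ be open and let ∇ be a torsion-free affine connection on U with curvature R_{ab}^c_d, and assume ∇_a R_{bc}^d_e = 0 on U. Let σ_b be a smooth 1-form and μ_{bc} a smooth 2-form on U such that μ(x) ∈ K_x for every x ∈ U. Then for every index a and every x ∈ U, the 2-form (b, c) ↦ ∇_a μ_{bc}(x) − R_{bc}^d_a(x) σ_d(x) also lies in K_x. (The subbundle Λ¹ ⊕ K ⊆ Λ¹ ⊕ Λ² is parallel for the Killing connection (σ_b, μ_{bc}) ↦ (∇_a σ_b − μ_{ab}, ∇_a μ_{bc} − R_{bc}^d_a σ_d).) -/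

import Mathlib

open scoped BigOperators

noncomputable section

/-- Partial derivative in coordinate direction `a`. -/
def pd {n : ℕ} (a : Fin n) (f : (Fin n → ℝ) → ℝ) (x : Fin n → ℝ) : ℝ :=
  fderiv ℝ f x (Pi.single a 1)

/-- Curvature `R_{ab}ᶜ_d` of the affine connection with Christoffel symbols `Γ`. -/
def curv {n : ℕ} (Γ : Fin n → Fin n → Fin n → (Fin n → ℝ) → ℝ)
    (a b c d : Fin n) (x : Fin n → ℝ) : ℝ :=
  pd a (Γ b d c) x - pd b (Γ a d c) x +
    ∑ e, (Γ b d e x * Γ a e c x - Γ a d e x * Γ b e c x)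

/-- Covariant derivative `∇_a R_{bc}ᵈ_e` of the curvature. -/
def covR {n : ℕ} (Γ : Fin n → Fin n → Fin n → (Fin n → ℝ) → ℝ)
    (a b c d e : Fin n) (x : Fin n → ℝ) : ℝ :=
  pd a (curv Γ b c d e) x - ∑ f, Γ a b f x * curv Γ f c d e x
    - ∑ f, Γ a c f x * curv Γ b f d e x + ∑ f, Γ a f d x * curv Γ b c f e x
    - ∑ f, Γ a e f x * curv Γ b c d f x

/-- Membership of an antisymmetric bilinear form `m` in the space `K_x`. -/
def Kmem {n : ℕ} (Γ : Fin n → Fin n → Fin n → (Fin n → ℝ) → ℝ)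
    (x : Fin n → ℝ) (m : Fin n → Fin n → ℝ) : Prop :=
  (∀ b c, m b c = - m c b) ∧
  ∀ a b c d, ∑ e, (curv Γ a b e c x * m d e - curv Γ a b e d x * m c e
    + curv Γ c d e a x * m b e - curv Γ c d e b x * m a e) = 0

/-- Covariant derivative `∇_a σ_b` of a 1-form. -/
def cov1 {n : ℕ} (Γ : Fin n → Fin n → Fin n → (Fin n → ℝ) → ℝ)
    (a : Fin n) (σ : Fin n → (Fin n → ℝ) → ℝ) (b : Fin n) (x : Fin n → ℝ) : ℝ :=
  pd a (σ b) x - ∑ e, Γ a b e x * σ e x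

/-- Covariant derivative `∇_a T_{bc}` of a covariant 2-tensor. -/
def cov2 {n : ℕ} (Γ : Fin n → Fin n → Fin n → (Fin n → ℝ) → ℝ)
    (a : Fin n) (T : Fin n → Fin n → (Fin n → ℝ) → ℝ) (b c : Fin n)
    (x : Fin n → ℝ) : ℝ :=
  pd a (T b c) x - ∑ e, Γ a b e x * T e c x - ∑ e, Γ a c e x * T b e x

open scoped ContDiff Topology

section PartialDerivative

variable {n : ℕ} {f g : (Fin n → ℝ) → ℝ} {x : Fin n → ℝ}

theorem pd_add (a : Fin n) (hf : DifferentiableAt ℝ f x) (hg : DifferentiableAt ℝ g x) :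
    pd a (fun y => f y + g y) x = pd a f x + pd a g x := by
  simp [pd, fderiv_fun_add hf hg]

theorem pd_sub (a : Fin n) (hf : DifferentiableAt ℝ f x) (hg : DifferentiableAt ℝ g x) :
    pd a (fun y => f y - g y) x = pd a f x - pd a g x := by
  simp [pd, fderiv_fun_sub hf hg]

theorem pd_neg (a : Fin n) (f : (Fin n → ℝ) → ℝ) (x : Fin n → ℝ) :
    pd a (fun y => - f y) x = - pd a f x := by
  simp [pd, fderiv_fun_neg]

theorem pd_mul (a : Fin n) (hf : DifferentiableAt ℝ f x) (hg : DifferentiableAt ℝ g x) :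
    pd a (fun y => f y * g y) x = pd a f x * g x + f x * pd a g x := by
  simp [pd, fderiv_fun_mul hf hg]
  ring

theorem pd_sum {ι : Type*} (s : Finset ι) (F : ι → (Fin n → ℝ) → ℝ) (a : Fin n)
    (hF : ∀ i, DifferentiableAt ℝ (F i) x) :
    pd a (fun y => ∑ i ∈ s, F i y) x = ∑ i ∈ s, pd a (F i) x := by
  simp [pd, fderiv_fun_sum (fun i _ => hF i)]

theorem pd_congr (a : Fin n) (h : f =ᶠ[𝓝 x] g) : pd a f x = pd a g x := by
  simp only [pd, h.fderiv_eq]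

theorem ContDiffAt.pd (a : Fin n) (hf : ContDiffAt ℝ ∞ f x) : ContDiffAt ℝ ∞ (pd a f) x :=
  (hf.fderiv_right (m := ∞) (by simp)).clm_apply contDiffAt_const

theorem pd_comm (a b : Fin n) (hf : ContDiffAt ℝ ∞ f x) :
    pd a (pd b f) x = pd b (pd a f) x := by
  have hd : DifferentiableAt ℝ (fderiv ℝ f) x :=
    (hf.fderiv_right (m := ∞) (by simp)).differentiableAt (by simp)
  have key : ∀ c d : Fin n,
      pd c (pd d f) x = fderiv ℝ (fderiv ℝ f) x (Pi.single c 1) (Pi.single d 1) := by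
    intro c d
    unfold pd
    rw [fderiv_clm_apply hd (differentiableAt_const _)]
    simp
  rw [key, key]
  exact hf.isSymmSndFDerivAt (by simpa using WithTop.coe_le_coe.2 (le_top : (2 : ℕ∞) ≤ ⊤)) _ _

end PartialDerivative

section TensorAction

variable {n : ℕ}

/-- The action of an endomorphism on tensors `T_{bc}ᵈ_e`, by derivations. -/
def curvAction (A : Fin n → Fin n → ℝ) (T : Fin n → Fin n → Fin n → Fin n → ℝ)
    (b c d e : Fin n) : ℝ :=
  ∑ f, A b f * T f c d e + ∑ f, A c f * T b f d e - ∑ f, A f d * T b c f e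
    + ∑ f, A e f * T b c d f

/-- The action of an endomorphism on covariant 2-tensors, by derivations. -/
def formAction (A : Fin n → Fin n → ℝ) (m : Fin n → Fin n → ℝ) (b c : Fin n) : ℝ :=
  ∑ f, A b f * m f c + ∑ f, A c f * m b f

/-- The action of an endomorphism on covariant 4-tensors, by derivations. -/
def quadAction (A : Fin n → Fin n → ℝ) (T : Fin n → Fin n → Fin n → Fin n → ℝ)
    (a b c d : Fin n) : ℝ :=
  ∑ f, A a f * T f b c d + ∑ f, A b f * T a f c d + ∑ f, A c f * T a b f d
    + ∑ f, A d f * T a b c f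

/-- The contraction `T_{ab}ᵉ_c m_{de}`. -/
def contraction (T : Fin n → Fin n → Fin n → Fin n → ℝ) (m : Fin n → Fin n → ℝ)
    (a b c d : Fin n) : ℝ :=
  ∑ e, T a b e c * m d e

/-- The tensor whose vanishing defines the space `K_x`. -/
def curvForm (T : Fin n → Fin n → Fin n → Fin n → ℝ) (m : Fin n → Fin n → ℝ)
    (a b c d : Fin n) : ℝ :=
  contraction T m a b c d - contraction T m a b d c + contraction T m c d a b
    - contraction T m c d b a

theorem curvAction_commutator (A B : Fin n → Fin n → ℝ)
    (T : Fin n → Fin n → Fin n → Fin n → ℝ) (b c d e : Fin n) :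
    curvAction A (curvAction B T) b c d e - curvAction B (curvAction A T) b c d e =
      curvAction (fun i j => ∑ k, (A i k * B k j - B i k * A k j)) T b c d e := by
  have comp : ∀ (X Y : Fin n → Fin n → ℝ) (t : Fin n → ℝ) (i : Fin n),
      ∑ f, X i f * ∑ g, Y f g * t g = ∑ f, (∑ k, X i k * Y k f) * t f := by
    intro X Y t i
    simp only [Finset.mul_sum, Finset.sum_mul]
    rw [Finset.sum_comm]
    simp only [mul_assoc]
  have swap : ∀ (X Y : Fin n → ℝ) (t : Fin n → Fin n → ℝ),
      ∑ f, X f * ∑ g, Y g * t f g = ∑ f, Y f * ∑ g, X g * t g f := by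
    intro X Y t
    simp only [Finset.mul_sum]
    rw [Finset.sum_comm]
    simp only [mul_left_comm]
  have comp' : ∀ (X Y : Fin n → Fin n → ℝ) (t : Fin n → ℝ) (i : Fin n),
      ∑ f, X f i * ∑ g, Y g f * t g = ∑ f, (∑ k, Y f k * X k i) * t f := by
    intro X Y t i
    simp only [Finset.mul_sum, Finset.sum_mul]
    rw [Finset.sum_comm]
    refine Finset.sum_congr rfl fun _ _ => Finset.sum_congr rfl fun _ _ => by ring
  simp only [curvAction, mul_add, mul_sub, Finset.sum_add_distrib, Finset.sum_sub_distrib,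
    sub_mul]
  rw [comp A B (fun f => T f c d e), comp B A (fun f => T f c d e),
    comp A B (fun f => T b f d e), comp B A (fun f => T b f d e),
    comp A B (fun f => T b c d f), comp B A (fun f => T b c d f),
    comp' A B (fun f => T b c f e), comp' B A (fun f => T b c f e),
    swap (A b) (B c) (fun f g => T f g d e), swap (A c) (B b) (fun f g => T g f d e),
    swap (A b) (B e) (fun f g => T f c d g), swap (A e) (B b) (fun f g => T g c d f),
    swap (A c) (B e) (fun f g => T b f d g), swap (A e) (B c) (fun f g => T b g d f),
    swap (A b) (fun g => B g d) (fun f g => T f c g e),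
    swap (fun g => A g d) (B b) (fun f g => T g c f e),
    swap (A c) (fun g => B g d) (fun f g => T b f g e),
    swap (fun g => A g d) (B c) (fun f g => T b g f e),
    swap (A e) (fun g => B g d) (fun f g => T b c g f),
    swap (fun g => A g d) (B e) (fun f g => T b c f g)]
  ring

theorem curvAction_add (A B : Fin n → Fin n → ℝ) (T : Fin n → Fin n → Fin n → Fin n → ℝ)
    (b c d e : Fin n) :
    curvAction (fun i j => A i j + B i j) T b c d e =
      curvAction A T b c d e + curvAction B T b c d e := by
  simp only [curvAction, add_mul, Finset.sum_add_distrib]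
  ring

theorem curvAction_sub (A B : Fin n → Fin n → ℝ) (T : Fin n → Fin n → Fin n → Fin n → ℝ)
    (b c d e : Fin n) :
    curvAction (fun i j => A i j - B i j) T b c d e =
      curvAction A T b c d e - curvAction B T b c d e := by
  simp only [curvAction, sub_mul, Finset.sum_sub_distrib]
  ring

theorem contraction_derivation (A : Fin n → Fin n → ℝ)
    (T : Fin n → Fin n → Fin n → Fin n → ℝ) (m : Fin n → Fin n → ℝ) (a b c d : Fin n) :
    contraction (curvAction A T) m a b c d + contraction T (formAction A m) a b c d =
      quadAction A (contraction T m) a b c d := by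
  simp only [contraction, curvAction, formAction, quadAction, add_mul, sub_mul, mul_add,
    Finset.sum_add_distrib, Finset.sum_sub_distrib, Finset.mul_sum, Finset.sum_mul]
  have h1 : ∑ e, ∑ f, A a f * T f b e c * m d e = ∑ f, ∑ e, A a f * (T f b e c * m d e) := by
    rw [Finset.sum_comm]; simp only [mul_assoc]
  have h2 : ∑ e, ∑ f, A b f * T a f e c * m d e = ∑ f, ∑ e, A b f * (T a f e c * m d e) := by
    rw [Finset.sum_comm]; simp only [mul_assoc]
  have h3 : ∑ e, ∑ f, A f e * T a b f c * m d e = ∑ e, ∑ f, T a b e c * (A e f * m d f) := by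
    rw [Finset.sum_comm]
    refine Finset.sum_congr rfl fun _ _ => Finset.sum_congr rfl fun _ _ => by ring
  have h4 : ∑ e, ∑ f, A c f * T a b e f * m d e = ∑ f, ∑ e, A c f * (T a b e f * m d e) := by
    rw [Finset.sum_comm]; simp only [mul_assoc]
  have h5 : ∑ e, ∑ f, T a b e c * (A d f * m f e) = ∑ f, ∑ e, A d f * (T a b e c * m f e) := by
    rw [Finset.sum_comm]; simp only [mul_left_comm]
  rw [h1, h2, h3, h4, h5]
  ring

theorem curvForm_derivation (A : Fin n → Fin n → ℝ)
    (T : Fin n → Fin n → Fin n → Fin n → ℝ) (m : Fin n → Fin n → ℝ) (a b c d : Fin n) :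
    curvForm (curvAction A T) m a b c d + curvForm T (formAction A m) a b c d =
      quadAction A (curvForm T m) a b c d := by
  have h1 := contraction_derivation A T m a b c d
  have h2 := contraction_derivation A T m a b d c
  have h3 := contraction_derivation A T m c d a b
  have h4 := contraction_derivation A T m c d b a
  have h5 : quadAction A (curvForm T m) a b c d =
      quadAction A (contraction T m) a b c d - quadAction A (contraction T m) a b d c
        + quadAction A (contraction T m) c d a b - quadAction A (contraction T m) c d b a := by
    simp only [quadAction, curvForm, mul_add, mul_sub, Finset.sum_add_distrib,
      Finset.sum_sub_distrib]
    ring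
  rw [h5, ← h1, ← h2, ← h3, ← h4]
  simp only [curvForm]
  ring

theorem curvForm_sub (T : Fin n → Fin n → Fin n → Fin n → ℝ) (m m' : Fin n → Fin n → ℝ)
    (a b c d : Fin n) :
    curvForm T (fun i j => m i j - m' i j) a b c d =
      curvForm T m a b c d - curvForm T m' a b c d := by
  simp only [curvForm, contraction, mul_sub, Finset.sum_sub_distrib]
  ring

/-- A curvature-like tensor annihilated by its own endomorphisms `T_{ab}` gives rise to solutions
of the equation defining `K_x`. -/
theorem curvForm_contract_eq_zero (T : Fin n → Fin n → Fin n → Fin n → ℝ)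
    (hanti : ∀ a b c d, T a b c d = - T b a c d)
    (hT : ∀ a b c d e f, curvAction (fun i j => T a b j i) T c d e f = 0)
    (s : Fin n → ℝ) (f a b c d : Fin n) :
    curvForm T (fun i j => ∑ g, T i j g f * s g) a b c d = 0 := by
  have key : ∀ g, ∑ e, (T a b e c * T d e g f - T a b e d * T c e g f
      + T c d e a * T b e g f - T c d e b * T a e g f) = 0 := by
    intro g
    have h1 := hT a b c d g f
    have h2 := hT c d a b g f
    simp only [curvAction] at h1 h2
    have h3 : ∑ e, T a b e c * T e d g f = - ∑ e, T a b e c * T d e g f := by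
      rw [← Finset.sum_neg_distrib]
      exact Finset.sum_congr rfl fun e _ => by rw [hanti e d]; ring
    have h4 : ∑ e, T c d e a * T e b g f = - ∑ e, T c d e a * T b e g f := by
      rw [← Finset.sum_neg_distrib]
      exact Finset.sum_congr rfl fun e _ => by rw [hanti e b]; ring
    have h5 : ∑ e, T c d g e * T a b e f = ∑ e, T a b e f * T c d g e :=
      Finset.sum_congr rfl fun e _ => mul_comm _ _
    have h6 : ∑ e, T c d e f * T a b g e = ∑ e, T a b g e * T c d e f :=
      Finset.sum_congr rfl fun e _ => mul_comm _ _
    rw [h3] at h1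
    rw [h4, h5, h6] at h2
    simp only [Finset.sum_add_distrib, Finset.sum_sub_distrib]
    linarith
  have h : curvForm T (fun i j => ∑ g, T i j g f * s g) a b c d =
      ∑ g, (∑ e, (T a b e c * T d e g f - T a b e d * T c e g f
      + T c d e a * T b e g f - T c d e b * T a e g f)) * s g := by
    simp only [curvForm, contraction, Finset.mul_sum, Finset.sum_mul]
    rw [Finset.sum_comm (f := fun e g => T a b e c * (T d e g f * s g)),
      Finset.sum_comm (f := fun e g => T a b e d * (T c e g f * s g)),
      Finset.sum_comm (f := fun e g => T c d e a * (T b e g f * s g)),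
      Finset.sum_comm (f := fun e g => T c d e b * (T a e g f * s g))]
    simp only [← Finset.sum_add_distrib, ← Finset.sum_sub_distrib]
    refine Finset.sum_congr rfl fun _ _ => Finset.sum_congr rfl fun _ _ => by ring
  rw [h]
  simp [key]

end TensorAction

section LocallySymmetric

variable {n : ℕ} {Γ : Fin n → Fin n → Fin n → (Fin n → ℝ) → ℝ} {x : Fin n → ℝ}

theorem curv_antisymm (Γ : Fin n → Fin n → Fin n → (Fin n → ℝ) → ℝ) (a b c d : Fin n)
    (x : Fin n → ℝ) : curv Γ a b c d x = - curv Γ b a c d x := by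
  simp only [curv, Finset.sum_sub_distrib]
  ring

theorem contDiffAt_curv (hΓ : ∀ a b c, ContDiffAt ℝ ∞ (Γ a b c) x) (a b c d : Fin n) :
    ContDiffAt ℝ ∞ (curv Γ a b c d) x := by
  unfold curv
  exact (((hΓ _ _ _).pd _).sub ((hΓ _ _ _).pd _)).add
    (ContDiffAt.sum fun e _ => ((hΓ _ _ _).mul (hΓ _ _ _)).sub ((hΓ _ _ _).mul (hΓ _ _ _)))

theorem pd_curv_of_covR_eq_zero {a b c d e : Fin n} (h : covR Γ a b c d e x = 0) :
    pd a (curv Γ b c d e) x =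
      curvAction (fun i j => Γ a i j x) (fun b c d e => curv Γ b c d e x) b c d e := by
  simp only [covR] at h
  simp only [curvAction]
  linarith

theorem pd_curvAction {A : Fin n → Fin n → (Fin n → ℝ) → ℝ}
    {T : Fin n → Fin n → Fin n → Fin n → (Fin n → ℝ) → ℝ}
    (hA : ∀ i j, DifferentiableAt ℝ (A i j) x)
    (hT : ∀ b c d e, DifferentiableAt ℝ (T b c d e) x) (a b c d e : Fin n) :
    pd a (fun y => curvAction (fun i j => A i j y) (fun b c d e => T b c d e y) b c d e) x =
      curvAction (fun i j => pd a (A i j) x) (fun b c d e => T b c d e x) b c d e +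
      curvAction (fun i j => A i j x) (fun b c d e => pd a (T b c d e) x) b c d e := by
  simp only [curvAction]
  rw [pd_add a (by fun_prop) (by fun_prop), pd_sub a (by fun_prop) (by fun_prop),
    pd_add a (by fun_prop) (by fun_prop), pd_sum _ _ _ (by fun_prop), pd_sum _ _ _ (by fun_prop),
    pd_sum _ _ _ (by fun_prop), pd_sum _ _ _ (by fun_prop)]
  simp only [pd_mul a (hA _ _) (hT _ _ _ _), Finset.sum_add_distrib]
  ring

/-- The Ricci identity for the curvature of an affine locally symmetric connection. -/
theorem curvAction_curv_eq_zero (hΓ : ∀ a b c, ContDiffAt ℝ ∞ (Γ a b c) x)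
    (hR : ∀ a b c d e, ∀ᶠ y in 𝓝 x, covR Γ a b c d e y = 0) (a b c d e f : Fin n) :
    curvAction (fun i j => curv Γ a b j i x) (fun c d e f => curv Γ c d e f x) c d e f = 0 := by
  have hA : ∀ a b c, DifferentiableAt ℝ (Γ a b c) x := fun a b c =>
    (hΓ a b c).differentiableAt (by simp)
  have hC : ∀ a b c d, DifferentiableAt ℝ (curv Γ a b c d) x := fun a b c d =>
    (contDiffAt_curv hΓ a b c d).differentiableAt (by simp)
  have second : ∀ a b, pd a (pd b (curv Γ c d e f)) x =
      curvAction (fun i j => pd a (Γ b i j) x) (fun c d e f => curv Γ c d e f x) c d e f +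
      curvAction (fun i j => Γ b i j x)
        (curvAction (fun i j => Γ a i j x) (fun c d e f => curv Γ c d e f x)) c d e f := by
    intro a b
    rw [pd_congr a ((hR b c d e f).mono fun y hy => pd_curv_of_covR_eq_zero hy),
      pd_curvAction (hA b) hC]
    congr 2
    funext c d e f
    exact pd_curv_of_covR_eq_zero (hR a c d e f).self_of_nhds
  have hsymm := pd_comm a b (contDiffAt_curv hΓ c d e f)
  rw [second, second] at hsymm
  have hcomm := curvAction_commutator (fun i j => Γ b i j x) (fun i j => Γ a i j x)
    (fun c d e f => curv Γ c d e f x) c d e f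
  simp only [curv.eq_def Γ a b]
  rw [curvAction_add, curvAction_sub]
  linarith

theorem kmem_iff (m : Fin n → Fin n → ℝ) :
    Kmem Γ x m ↔ (∀ b c, m b c = - m c b) ∧
      ∀ a b c d, curvForm (fun a b c d => curv Γ a b c d x) m a b c d = 0 := by
  simp only [Kmem, curvForm, contraction, Finset.sum_add_distrib, Finset.sum_sub_distrib]

theorem pd_curvForm {T : Fin n → Fin n → Fin n → Fin n → (Fin n → ℝ) → ℝ}
    {m : Fin n → Fin n → (Fin n → ℝ) → ℝ}
    (hT : ∀ b c d e, DifferentiableAt ℝ (T b c d e) x)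
    (hm : ∀ i j, DifferentiableAt ℝ (m i j) x) (f a b c d : Fin n) :
    pd f (fun y => curvForm (fun a b c d => T a b c d y) (fun i j => m i j y) a b c d) x =
      curvForm (fun a b c d => pd f (T a b c d) x) (fun i j => m i j x) a b c d +
      curvForm (fun a b c d => T a b c d x) (fun i j => pd f (m i j) x) a b c d := by
  simp only [curvForm, contraction]
  rw [pd_sub f (by fun_prop) (by fun_prop), pd_add f (by fun_prop) (by fun_prop),
    pd_sub f (by fun_prop) (by fun_prop), pd_sum _ _ _ (by fun_prop), pd_sum _ _ _ (by fun_prop),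
    pd_sum _ _ _ (by fun_prop), pd_sum _ _ _ (by fun_prop)]
  simp only [pd_mul f (hT _ _ _ _) (hm _ _), Finset.sum_add_distrib]
  ring

theorem cov2_eq (m : Fin n → Fin n → (Fin n → ℝ) → ℝ) (a b c : Fin n) :
    cov2 Γ a m b c x =
      pd a (m b c) x - formAction (fun i j => Γ a i j x) (fun i j => m i j x) b c := by
  simp only [cov2, formAction]
  ring

/-- The covariant derivative of a section of `K` is again a section of `K`. -/
theorem kmem_cov2 (hΓ : ∀ a b c, ContDiffAt ℝ ∞ (Γ a b c) x)
    (hR : ∀ a b c d e, covR Γ a b c d e x = 0) {m : Fin n → Fin n → (Fin n → ℝ) → ℝ}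
    (hm : ∀ i j, DifferentiableAt ℝ (m i j) x)
    (hK : ∀ᶠ y in 𝓝 x, Kmem Γ y (fun i j => m i j y)) (f : Fin n) :
    Kmem Γ x (fun b c => cov2 Γ f m b c x) := by
  have hC : ∀ a b c d, DifferentiableAt ℝ (curv Γ a b c d) x := fun a b c d =>
    (contDiffAt_curv hΓ a b c d).differentiableAt (by simp)
  have hx := (kmem_iff _).1 hK.self_of_nhds
  refine (kmem_iff _).2 ⟨fun b c => ?_, fun a b c d => ?_⟩
  · have hpd : pd f (m b c) x = - pd f (m c b) x := by
      rw [pd_congr f (hK.mono fun y hy => hy.1 b c), pd_neg]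
    have h1 : ∑ e, Γ f b e x * m e c x = - ∑ e, Γ f b e x * m c e x := by
      rw [← Finset.sum_neg_distrib]
      exact Finset.sum_congr rfl fun e _ => by rw [hx.1 e c]; ring
    have h2 : ∑ e, Γ f c e x * m b e x = - ∑ e, Γ f c e x * m e b x := by
      rw [← Finset.sum_neg_distrib]
      exact Finset.sum_congr rfl fun e _ => by rw [hx.1 b e]; ring
    simp only [cov2, hpd, h1, h2]
    ring
  · have h0 : pd f (fun y => curvForm (fun a b c d => curv Γ a b c d y)
        (fun i j => m i j y) a b c d) x = 0 := by
      rw [pd_congr f (g := fun _ => 0)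
        (hK.mono fun y hy => ((kmem_iff _).1 hy).2 a b c d)]
      simp [pd]
    rw [pd_curvForm hC hm] at h0
    have hL : (fun a b c d => pd f (curv Γ a b c d) x) =
        curvAction (fun i j => Γ f i j x) (fun a b c d => curv Γ a b c d x) := by
      funext a b c d
      exact pd_curv_of_covR_eq_zero (hR f a b c d)
    have hder := curvForm_derivation (fun i j => Γ f i j x) (fun a b c d => curv Γ a b c d x)
      (fun i j => m i j x) a b c d
    have hquad : quadAction (fun i j => Γ f i j x)
        (curvForm (fun a b c d => curv Γ a b c d x) (fun i j => m i j x)) a b c d = 0 := by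
      simp [quadAction, hx.2]
    simp only [cov2_eq]
    rw [curvForm_sub]
    rw [hL] at h0
    linarith

end LocallySymmetric

/-- **The subbundle `Λ¹ ⊕ K` is parallel for the Killing connection.**
If `∇` is affine locally symmetric, `σ` is a smooth 1-form and `μ` is a smooth
2-form with `μ(x) ∈ K_x` for all `x ∈ U`, then for every `a` and `x ∈ U` the
2-form `(b,c) ↦ ∇_a μ_{bc}(x) − R_{bc}ᵈ_a(x) σ_d(x)` also lies in `K_x`. -/
theorem Killing_connection_preserves_K
    {n : ℕ} (hn : 1 ≤ n) (U : Set (Fin n → ℝ)) (hU : IsOpen U)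
    (Γ : Fin n → Fin n → Fin n → (Fin n → ℝ) → ℝ)
    (hΓsmooth : ∀ a b c, ContDiffOn ℝ (⊤ : ℕ∞) (Γ a b c) U)
    (hΓsym : ∀ a b c, ∀ x ∈ U, Γ a b c x = Γ b a c x)
    (hlocsym : ∀ a b c d e, ∀ x ∈ U, covR Γ a b c d e x = 0)
    (σ : Fin n → (Fin n → ℝ) → ℝ)
    (hσsmooth : ∀ b, ContDiffOn ℝ (⊤ : ℕ∞) (σ b) U)
    (μ : Fin n → Fin n → (Fin n → ℝ) → ℝ)
    (hμsmooth : ∀ b c, ContDiffOn ℝ (⊤ : ℕ∞) (μ b c) U)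
    (hμK : ∀ x ∈ U, Kmem Γ x (fun b c => μ b c x)) :
    ∀ (a : Fin n), ∀ x ∈ U,
      Kmem Γ x (fun b c => cov2 Γ a μ b c x - ∑ d, curv Γ b c d a x * σ d x) := by
  intro a x hx
  have hUx : U ∈ 𝓝 x := hU.mem_nhds hx
  have hΓ : ∀ a b c, ContDiffAt ℝ ∞ (Γ a b c) x := fun a b c => (hΓsmooth a b c).contDiffAt hUx
  have hcov := (kmem_iff _).1 (kmem_cov2 hΓ (fun a b c d e => hlocsym a b c d e x hx)
    (fun i j => ((hμsmooth i j).contDiffAt hUx).differentiableAt (by simp))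
    (Filter.eventually_of_mem hUx hμK) a)
  refine (kmem_iff _).2 ⟨fun b c => ?_, fun b c d e => ?_⟩
  · have h : ∑ d, curv Γ b c d a x * σ d x = - ∑ d, curv Γ c b d a x * σ d x := by
      rw [← Finset.sum_neg_distrib]
      exact Finset.sum_congr rfl fun d _ => by rw [curv_antisymm Γ b c]; ring
    simp only [hcov.1 b c, h]
    ring
  · rw [curvForm_sub, hcov.2,
      curvForm_contract_eq_zero (fun a b c d => curv Γ a b c d x)
        (fun a b c d => curv_antisymm Γ a b c d x)
        (curvAction_curv_eq_zero hΓ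
          (fun a b c d e => Filter.eventually_of_mem hUx (hlocsym a b c d e)))
        (fun d => σ d x), sub_zero]

end
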